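/- Gaussian mechanism privacy curve: let f : X → ℝ^d have global ℓ2-sensitivity Δ. For any ε > 0 and δ ∈ [0,1], the mechanism M(x) = f(x) + Z with Z ~ N(0, σ²I) is (ε, δ)-DP if and only if Φ(Δ/(2σ) − εσ/Δ) − e^ε · Φ(−Δ/(2σ) − εσ/Δ) ≤ δ, where Φ is the standard normal CDF. -/

import Mathlib

open MeasureTheory

/-- The standard normal cumulative distribution function `Φ`. -/
noncomputable def Phi (t : ℝ) : ℝ :=
  ((ProbabilityTheory.gaussianReal 0 1) (Set.Iic t)).toReal

variable {X : Type*}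

/-- `(ε, δ)`-differential privacy with respect to a neighboring relation `N`. -/
def IsDP {Ω : Type*} [MeasurableSpace Ω] (N : X → X → Prop)
    (M : X → Measure Ω) (ε δ : ℝ) : Prop :=
  ∀ D D', N D D' → ∀ S : Set Ω, MeasurableSet S →
    M D S ≤ ENNReal.ofReal (Real.exp ε) * M D' S + ENNReal.ofReal δ

open ProbabilityTheory
open scoped NNReal ENNReal

/-- The standard normal cumulative distribution function has the standard normal density as its
derivative. -/
lemma hasDerivAt_Phi (t : ℝ) : HasDerivAt Phi (gaussianPDFReal 0 1 t) t := by
  have hint : Integrable (gaussianPDFReal 0 1) := integrable_gaussianPDFReal 0 1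
  have hcont : Continuous (gaussianPDFReal 0 1) := by
    unfold gaussianPDFReal
    fun_prop
  have hPhi (s : ℝ) : Phi s = ∫ x in Set.Iic s, gaussianPDFReal 0 1 x := by
    rw [Phi, gaussianReal_apply_eq_integral 0 one_ne_zero, ENNReal.toReal_ofReal]
    exact integral_nonneg fun x => gaussianPDFReal_nonneg 0 1 x
  have heq : Phi = fun s => Phi 0 + ∫ x in (0 : ℝ)..s, gaussianPDFReal 0 1 x := by
    funext s
    rw [intervalIntegral.integral_Iic_sub_Iic hint.integrableOn hint.integrableOn |>.symm,
      hPhi s, hPhi 0]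
    ring
  rw [heq]
  exact (intervalIntegral.integral_hasDerivAt_right (hcont.intervalIntegrable _ _)
    hcont.stronglyMeasurable.stronglyMeasurableAtFilter hcont.continuousAt).const_add _

/-- The smallest `δ` for which a Gaussian mechanism with noise level `σ` is `(ε, δ)`-private on a
pair of inputs whose images are at distance `s`. -/
noncomputable def gaussianPrivacyCurve (σ ε s : ℝ) : ℝ :=
  Phi (s / (2 * σ) - ε * σ / s) - Real.exp ε * Phi (-(s / (2 * σ)) - ε * σ / s)

lemma hasDerivAt_gaussianPrivacyCurve {σ s : ℝ} (ε : ℝ) (hσ : 0 < σ) (hs : 0 < s) :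
    HasDerivAt (gaussianPrivacyCurve σ ε)
      (gaussianPDFReal 0 1 (s / (2 * σ) - ε * σ / s) / σ) s := by
  have hlin : HasDerivAt (fun s : ℝ => s / (2 * σ)) (1 / (2 * σ)) s :=
    (hasDerivAt_id s).div_const _
  have hinv : HasDerivAt (fun s : ℝ => ε * σ / s) (ε * σ * (-(s ^ 2)⁻¹)) s := by
    simpa only [div_eq_mul_inv] using (hasDerivAt_inv hs.ne').const_mul (ε * σ)
  have hcurve := ((hasDerivAt_Phi _).comp s (hlin.sub hinv)).sub
    (((hasDerivAt_Phi _).comp s (hlin.neg.sub hinv)).const_mul (Real.exp ε))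
  refine hcurve.congr_deriv ?_
  have hpdf : Real.exp ε * gaussianPDFReal 0 1 (-(s / (2 * σ)) - ε * σ / s) =
      gaussianPDFReal 0 1 (s / (2 * σ) - ε * σ / s) := by
    simp only [gaussianPDFReal]
    rw [mul_left_comm, ← Real.exp_add]
    congr 2
    push_cast
    field_simp
    ring
  simp only [Pi.sub_apply, Pi.neg_apply]
  rw [← mul_assoc, hpdf]
  field_simp
  ring

lemma monotoneOn_gaussianPrivacyCurve {σ : ℝ} (ε : ℝ) (hσ : 0 < σ) :
    MonotoneOn (gaussianPrivacyCurve σ ε) (Set.Ioi 0) := by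
  refine monotoneOn_of_deriv_nonneg (convex_Ioi 0)
    (fun s hs => (hasDerivAt_gaussianPrivacyCurve ε hσ hs).continuousAt.continuousWithinAt)
    (fun s hs => ?_) (fun s hs => ?_)
  all_goals rw [interior_Ioi] at hs
  · exact (hasDerivAt_gaussianPrivacyCurve ε hσ hs).differentiableAt.differentiableWithinAt
  · rw [(hasDerivAt_gaussianPrivacyCurve ε hσ hs).deriv]
    exact div_nonneg (gaussianPDFReal_nonneg _ _ _) hσ.le

lemma gaussianReal_real_Iic {v : ℝ≥0} {τ : ℝ} (m c : ℝ) (hτ : 0 < τ) (hv : (v : ℝ) = τ ^ 2) :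
    (gaussianReal m v).real (Set.Iic c) = Phi ((c - m) / τ) := by
  have hmap : (gaussianReal 0 1).map (fun x => m + τ * x) = gaussianReal m v := by
    have hcomp : (fun x : ℝ => m + τ * x) = (fun x => m + x) ∘ fun x => τ * x := rfl
    rw [hcomp, ← Measure.map_map (by fun_prop) (by fun_prop), gaussianReal_map_const_mul,
      gaussianReal_map_const_add]
    congr 1
    · simp
    · ext
      simp [hv]
  rw [← hmap, map_measureReal_apply (by fun_prop) measurableSet_Iic, Phi, measureReal_def]
  congr 2
  ext x
  simp only [Set.mem_preimage, Set.mem_Iic, le_div_iff₀ hτ]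
  constructor <;> intro h <;> linarith

lemma pi_gaussianReal_map_sum_mul {ι : Type*} [Fintype ι] (m a : ι → ℝ) (v : ℝ≥0) :
    (Measure.pi fun i => gaussianReal (m i) v).map (fun x => ∑ i, a i * x i) =
      gaussianReal (∑ i, a i * m i) (∑ i, NNReal.mk (a i ^ 2) (sq_nonneg _) * v) := by
  have hmap (i : ι) : (Measure.pi fun i => gaussianReal (m i) v).map (fun x => a i * x i) =
      gaussianReal (a i * m i) (NNReal.mk (a i ^ 2) (sq_nonneg _) * v) := by
    have hcomp : (fun x : ι → ℝ => a i * x i) = (fun x => a i * x) ∘ fun x => x i := rfl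
    rw [hcomp, ← Measure.map_map (by fun_prop) (by fun_prop),
      (measurePreserving_eval (fun i => gaussianReal (m i) v) i).map_eq,
      gaussianReal_map_const_mul]
  have hmeas (i : ι) : AEMeasurable (fun x : ι → ℝ => a i * x i)
      (Measure.pi fun i => gaussianReal (m i) v) :=
    Measurable.aemeasurable (by fun_prop)
  have hindep : iIndepFun (fun i (x : ι → ℝ) => a i * x i)
      (Measure.pi fun i => gaussianReal (m i) v) :=
    iIndepFun_pi (X := fun i x => a i * x) fun i => by fun_prop
  refine Measure.ext_of_charFun ?_
  rw [hindep.charFun_map_fun_sum_eq_prod hmeas]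
  ext t
  simp only [hmap, Finset.prod_apply, charFun_gaussianReal, ← Complex.exp_sum]
  congr 1
  push_cast
  rw [Finset.sum_sub_distrib, Finset.mul_sum, Finset.sum_mul, Finset.sum_mul, Finset.sum_div]

/-- A product of probability measures with densities has the product density. -/
lemma pi_withDensity {ι : Type*} [Fintype ι] {α : ι → Type*} [∀ i, MeasurableSpace (α i)]
    (μ : ∀ i, Measure (α i)) [∀ i, IsProbabilityMeasure (μ i)] (r : ∀ i, α i → ℝ≥0∞)
    (hr : ∀ i, Measurable (r i)) [∀ i, SigmaFinite ((μ i).withDensity (r i))] :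
    Measure.pi (fun i => (μ i).withDensity (r i)) =
      (Measure.pi μ).withDensity fun x => ∏ i, r i (x i) := by
  refine Measure.pi_eq fun s hs => ?_
  have hmeas (i : ι) : Measurable ((s i).indicator (r i)) := (hr i).indicator (hs i)
  have hprod (x : ∀ i, α i) : (Set.univ.pi s).indicator (fun x => ∏ i, r i (x i)) x =
      ∏ i, (s i).indicator (r i) (x i) := by
    by_cases hx : x ∈ Set.univ.pi s
    · rw [Set.indicator_of_mem hx]
      exact Finset.prod_congr rfl fun i _ => (Set.indicator_of_mem (hx i trivial) _).symm
    · rw [Set.indicator_of_notMem hx]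
      obtain ⟨i, hi⟩ : ∃ i, x i ∉ s i := by simpa [Set.mem_pi] using hx
      exact (Finset.prod_eq_zero (Finset.mem_univ i) (Set.indicator_of_notMem hi _)).symm
  have hpi : MeasurableSet (Set.univ.pi s) := MeasurableSet.univ_pi hs
  rw [withDensity_apply _ hpi, ← lintegral_indicator hpi]
  simp only [hprod]
  rw [lintegral_prod_eq_prod_lintegral_of_indepFun Finset.univ
    (fun i (x : ∀ i, α i) => (s i).indicator (r i) (x i))
    (iIndepFun_pi fun i => (hmeas i).aemeasurable) fun i => (hmeas i).comp (measurable_pi_apply i)]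
  refine Finset.prod_congr rfl fun i _ => ?_
  rw [withDensity_apply _ (hs i), ← lintegral_indicator (hs i)]
  exact (measurePreserving_eval μ i).lintegral_comp (hmeas i)

lemma gaussianReal_eq_withDensity_gaussianReal (m n : ℝ) {v : ℝ≥0} (hv : v ≠ 0) :
    gaussianReal m v = (gaussianReal n v).withDensity
      fun x => ENNReal.ofReal (Real.exp ((m - n) * (x - (m + n) / 2) / v)) := by
  have hv' : (v : ℝ) ≠ 0 := by exact_mod_cast hv
  rw [gaussianReal_of_var_ne_zero m hv, gaussianReal_of_var_ne_zero n hv,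
    ← withDensity_mul _ (measurable_gaussianPDF n v) (by fun_prop)]
  congr 1
  ext x
  rw [Pi.mul_apply, gaussianPDF, gaussianPDF, ← ENNReal.ofReal_mul (gaussianPDFReal_nonneg _ _ _)]
  congr 1
  simp only [gaussianPDFReal]
  rw [mul_assoc (√_)⁻¹, ← Real.exp_add]
  congr 2
  field_simp
  ring

lemma pi_gaussianReal_eq_withDensity {ι : Type*} [Fintype ι] (m n : ι → ℝ) {v : ℝ≥0}
    (hv : v ≠ 0) :
    Measure.pi (fun i => gaussianReal (m i) v) =
      (Measure.pi fun i => gaussianReal (n i) v).withDensity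
        fun x => ENNReal.ofReal
          (Real.exp ((∑ i, (m i - n i) * (x i - (m i + n i) / 2)) / v)) := by
  have hdens (i : ι) := gaussianReal_eq_withDensity_gaussianReal (m i) (n i) hv
  have hfin (i : ι) : SigmaFinite ((gaussianReal (n i) v).withDensity
      fun x => ENNReal.ofReal (Real.exp ((m i - n i) * (x - (m i + n i) / 2) / v))) := by
    rw [← hdens i]
    infer_instance
  rw [funext hdens, pi_withDensity _ _ fun i => by fun_prop]
  congr 1
  ext x
  rw [← ENNReal.ofReal_prod_of_nonneg fun i _ => (Real.exp_pos _).le, ← Real.exp_sum,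
    Finset.sum_div]

/-- Neyman-Pearson: a superlevel set `A` of the density `r` maximizes `S ↦ P S - c * Q S`. -/
lemma withDensity_add_mul_le {Ω : Type*} [MeasurableSpace Ω] (Q : Measure Ω) (r : Ω → ℝ≥0∞)
    (c : ℝ≥0∞) {A S : Set Ω} (hA : MeasurableSet A) (hS : MeasurableSet S)
    (hle : ∀ x ∈ A, c ≤ r x) (hge : ∀ x ∉ A, r x ≤ c) :
    Q.withDensity r S + c * Q A ≤ Q.withDensity r A + c * Q S := by
  have hout : Q.withDensity r (S \ A) ≤ c * Q (S \ A) := by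
    rw [withDensity_apply _ (hS.diff hA), ← setLIntegral_const]
    exact setLIntegral_mono' (hS.diff hA) fun x hx => hge x hx.2
  have hin : c * Q (A \ S) ≤ Q.withDensity r (A \ S) := by
    rw [withDensity_apply _ (hA.diff hS), ← setLIntegral_const]
    exact setLIntegral_mono' (hA.diff hS) fun x hx => hle x hx.1
  rw [← measure_inter_add_sdiff (μ := Q.withDensity r) S hA,
    ← measure_inter_add_sdiff (μ := Q.withDensity r) A hS,
    ← measure_inter_add_sdiff (μ := Q) S hA, ← measure_inter_add_sdiff (μ := Q) A hS,
    Set.inter_comm A S, mul_add, mul_add]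
  calc _ = Q.withDensity r (S ∩ A) + c * Q (S ∩ A) +
        (Q.withDensity r (S \ A) + c * Q (A \ S)) := by ring
    _ ≤ Q.withDensity r (S ∩ A) + c * Q (S ∩ A) +
        (c * Q (S \ A) + Q.withDensity r (A \ S)) := by gcongr
    _ = _ := by ring

lemma measure_le_mul_add_iff {Ω : Type*} [MeasurableSpace Ω] (P Q : Measure Ω) [IsFiniteMeasure P]
    [IsFiniteMeasure Q] {c δ : ℝ} (hc : 0 ≤ c) (hδ : 0 ≤ δ) (S : Set Ω) :
    P S ≤ ENNReal.ofReal c * Q S + ENNReal.ofReal δ ↔ P.real S - c * Q.real S ≤ δ := by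
  rw [← ofReal_measureReal (μ := P), ← ofReal_measureReal (μ := Q), ← ENNReal.ofReal_mul hc,
    ← ENNReal.ofReal_add (by positivity) hδ, ENNReal.ofReal_le_ofReal_iff (by positivity),
    sub_le_iff_le_add']

/-- The exact privacy guarantee of Gaussian noise on a single pair of distinct means. -/
lemma pi_gaussianReal_le_iff {ι : Type*} [Fintype ι] (m n : ι → ℝ) {v : ℝ≥0} {σ s ε δ : ℝ}
    (hσ : 0 < σ) (hs : 0 < s) (hδ : 0 ≤ δ) (hv : (v : ℝ) = σ ^ 2)
    (hsum : ∑ i, (m i - n i) ^ 2 = s ^ 2) :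
    (∀ S : Set (ι → ℝ), MeasurableSet S →
      Measure.pi (fun i => gaussianReal (m i) v) S ≤
        ENNReal.ofReal (Real.exp ε) * Measure.pi (fun i => gaussianReal (n i) v) S +
          ENNReal.ofReal δ) ↔ gaussianPrivacyCurve σ ε s ≤ δ := by
  have hv0 : v ≠ 0 := by
    rw [← NNReal.coe_ne_zero, hv]
    positivity
  have hdens := pi_gaussianReal_eq_withDensity m n hv0
  set P := Measure.pi fun i => gaussianReal (m i) v with hP
  set Q := Measure.pi fun i => gaussianReal (n i) v with hQ
  set ℓ : (ι → ℝ) → ℝ := fun x => ∑ i, (m i - n i) * (x i - (m i + n i) / 2) with hℓ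
  set A : Set (ι → ℝ) := {x | ε * σ ^ 2 ≤ ℓ x} with hAdef
  have hA : MeasurableSet A := measurableSet_le (by fun_prop) (by fun_prop)
  have hApre : A = (fun x : ι → ℝ => ∑ i, (n i - m i) * x i) ⁻¹'
      Set.Iic (-(ε * σ ^ 2) - ∑ i, (m i - n i) * ((m i + n i) / 2)) := by
    ext x
    have hx : ℓ x = -(∑ i, (n i - m i) * x i) - ∑ i, (m i - n i) * ((m i + n i) / 2) := by
      rw [hℓ, ← Finset.sum_neg_distrib, ← Finset.sum_sub_distrib]
      exact Finset.sum_congr rfl fun i _ => by ring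
    simp only [hAdef, Set.mem_ofPred_eq, Set.mem_preimage, Set.mem_Iic, hx]
    constructor <;> intro h <;> linarith
  have hvar : ((∑ i, NNReal.mk ((n i - m i) ^ 2) (sq_nonneg _) * v : ℝ≥0) : ℝ) = (s * σ) ^ 2 := by
    push_cast
    rw [← Finset.sum_mul, hv, mul_pow, ← hsum]
    congr 1
    exact Finset.sum_congr rfl fun i _ => by ring
  have hlaw (p : ι → ℝ) : (Measure.pi fun i => gaussianReal (p i) v).real A =
      Phi ((-(ε * σ ^ 2) - ∑ i, (m i - n i) * ((m i + n i) / 2) -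
        ∑ i, (n i - m i) * p i) / (s * σ)) := by
    rw [hApre, ← map_measureReal_apply (by fun_prop) measurableSet_Iic,
      pi_gaussianReal_map_sum_mul p (fun i => n i - m i) v,
      gaussianReal_real_Iic _ _ (by positivity) hvar]
  have hPA : P.real A = Phi (s / (2 * σ) - ε * σ / s) := by
    have hmean : ∑ i, (m i - n i) * ((m i + n i) / 2) + ∑ i, (n i - m i) * m i =
        -(s ^ 2 / 2) := by
      rw [← hsum, ← Finset.sum_add_distrib, Finset.sum_div, ← Finset.sum_neg_distrib]
      exact Finset.sum_congr rfl fun i _ => by ring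
    rw [hP, hlaw, sub_sub, hmean]
    congr 1
    field_simp
    ring
  have hQA : Q.real A = Phi (-(s / (2 * σ)) - ε * σ / s) := by
    have hmean : ∑ i, (m i - n i) * ((m i + n i) / 2) + ∑ i, (n i - m i) * n i =
        s ^ 2 / 2 := by
      rw [← hsum, ← Finset.sum_add_distrib, Finset.sum_div]
      exact Finset.sum_congr rfl fun i _ => by ring
    rw [hQ, hlaw, sub_sub, hmean]
    congr 1
    field_simp
    ring
  have hcurve : gaussianPrivacyCurve σ ε s = P.real A - Real.exp ε * Q.real A := by
    rw [hPA, hQA, gaussianPrivacyCurve]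
  rw [hcurve]
  refine ⟨fun h => (measure_le_mul_add_iff P Q (Real.exp_pos ε).le hδ A).1 (h A hA),
    fun h S hS => (measure_le_mul_add_iff P Q (Real.exp_pos ε).le hδ S).2 (le_trans ?_ h)⟩
  have hmem (x : ι → ℝ) : x ∈ A ↔ ε ≤ ℓ x / v := by
    rw [hv, le_div_iff₀ (by positivity)]
    rfl
  have hNP := withDensity_add_mul_le Q (fun x => ENNReal.ofReal (Real.exp (ℓ x / v)))
    (ENNReal.ofReal (Real.exp ε)) hA hS
    (fun x hx => ENNReal.ofReal_le_ofReal (Real.exp_le_exp.2 ((hmem x).1 hx)))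
    (fun x hx => ENNReal.ofReal_le_ofReal
      (Real.exp_le_exp.2 (not_le.1 fun h => hx ((hmem x).2 h)).le))
  rw [← hdens, ← ofReal_measureReal (μ := P), ← ofReal_measureReal (μ := P),
    ← ofReal_measureReal (μ := Q), ← ofReal_measureReal (μ := Q),
    ← ENNReal.ofReal_mul (Real.exp_pos ε).le, ← ENNReal.ofReal_mul (Real.exp_pos ε).le,
    ← ENNReal.ofReal_add (by positivity) (by positivity),
    ← ENNReal.ofReal_add (by positivity) (by positivity),
    ENNReal.ofReal_le_ofReal_iff (by positivity)] at hNP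
  linarith

/-- Privacy curve of the Gaussian mechanism (Balle–Wang): for `f : X → ℝ^d` of
global ℓ2-sensitivity `Δ`, the mechanism `M(x) = f(x) + N(0, σ²I)` is
`(ε, δ)`-DP if and only if `Φ(Δ/(2σ) − εσ/Δ) − e^ε·Φ(−Δ/(2σ) − εσ/Δ) ≤ δ`. -/
theorem gaussian_mechanism_privacy_curve
    (N : X → X → Prop) (d : ℕ) (f : X → Fin d → ℝ) (Δ σ ε δ : ℝ)
    (hΔ : 0 < Δ) (hσ : 0 < σ) (hε : 0 < ε) (hδ0 : 0 ≤ δ) (hδ1 : δ ≤ 1)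
    (hsens : Δ = sSup {x : ℝ | ∃ D D', N D D' ∧
        x = Real.sqrt (∑ i, (f D i - f D' i) ^ 2)}) :
    IsDP N
        (fun D => Measure.pi fun i : Fin d =>
          ProbabilityTheory.gaussianReal (f D i) ⟨σ ^ 2, sq_nonneg σ⟩) ε δ ↔
      Phi (Δ / (2 * σ) - ε * σ / Δ) -
          Real.exp ε * Phi (-(Δ / (2 * σ)) - ε * σ / Δ) ≤ δ := by
  set T : Set ℝ := {x : ℝ | ∃ D D', N D D' ∧ x = Real.sqrt (∑ i, (f D i - f D' i) ^ 2)}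
  have hbdd : BddAbove T := by
    by_contra h
    rw [Real.sSup_of_not_bddAbove h] at hsens
    exact hΔ.ne' hsens
  have hne : T.Nonempty := by
    by_contra h
    rw [Set.not_nonempty_iff_eq_empty.1 h, Real.sSup_empty] at hsens
    exact hΔ.ne' hsens
  have hpair (D D' : X) (hs : 0 < Real.sqrt (∑ i, (f D i - f D' i) ^ 2)) :=
    pi_gaussianReal_le_iff (f D) (f D') (v := ⟨σ ^ 2, sq_nonneg σ⟩) (ε := ε) hσ hs hδ0 rfl
      (Real.sq_sqrt (Finset.sum_nonneg fun i _ => sq_nonneg _)).symm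
  change _ ↔ gaussianPrivacyCurve σ ε Δ ≤ δ
  constructor
  · intro hDP
    by_contra! hlt
    have hnear := (hasDerivAt_gaussianPrivacyCurve ε hσ hΔ).continuousAt.eventually_const_lt hlt
    obtain ⟨l, hl, hlmem⟩ := exists_Ioc_subset_of_mem_nhds hnear ⟨0, hΔ⟩
    obtain ⟨s, hsT, hs⟩ := exists_lt_of_lt_csSup hne (hsens ▸ max_lt hl hΔ : max l 0 < sSup T)
    have hsΔ : s ≤ Δ := hsens ▸ le_csSup hbdd hsT
    have hδs : δ < gaussianPrivacyCurve σ ε s :=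
      hlmem ⟨(le_max_left l 0).trans_lt hs, hsΔ⟩
    have hs0 : 0 < s := (le_max_right l 0).trans_lt hs
    obtain ⟨D, D', hN, rfl⟩ := hsT
    exact hδs.not_ge ((hpair D D' hs0).1 (hDP D D' hN))
  · intro hcurve D D' hN
    rcases (Real.sqrt_nonneg (∑ i, (f D i - f D' i) ^ 2)).eq_or_lt with hs | hs
    · have hzero := (Real.sqrt_eq_zero (Finset.sum_nonneg fun i _ => sq_nonneg _)).1 hs.symm
      have heq : f D = f D' := by
        funext i
        have hi := (Finset.sum_eq_zero_iff_of_nonneg fun i _ => sq_nonneg _).1 hzero i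
          (Finset.mem_univ i)
        exact sub_eq_zero.1 (pow_eq_zero_iff two_ne_zero |>.1 hi)
      intro S _
      simp only [heq]
      refine le_add_right (le_mul_of_one_le_left zero_le ?_)
      exact ENNReal.one_le_ofReal.2 (Real.one_le_exp hε.le)
    · refine (hpair D D' hs).2 (le_trans ?_ hcurve)
      refine monotoneOn_gaussianPrivacyCurve ε hσ hs hΔ ?_
      exact hsens ▸ le_csSup hbdd ⟨D, D', hN, rfl⟩
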